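/- arXiv:2309.12831 — 2 statements merged into one kernel-verified Lean document; each statement's English description precedes it below -/
import Mathlib

section
/- Let φ : H → GL(m,ℤ) be an integral representation of a finite group H that is irreducible over ℚ and whose absolutely irreducible subrepresentations over ℂ have dimension k. Then RF_{ℤ^m, Com(φ), B_{ℤ^m}} ⪰ log^k, i.e., log^k ⪯ RF_{ℤ^m, Com(φ), B_{ℤ^m}}. -/
/-- The word ball of radius `r` in an additive group with respect to a finite
(generating) set `S`: sums of at most `r` elements of `S ∪ (-S)`. -/
def addWordBall {A : Type*} [AddGroup A] (S : Finset A) (r : ℝ) : Set A :=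
  {a | ∃ l : List A, (∀ x ∈ l, x ∈ S ∨ -x ∈ S) ∧ (l.length : ℝ) ≤ r ∧ l.sum = a}

/-- The divisibility function `D_{A,P}(a) = min {[A:N] : N ∈ P, a ∉ N}`, with value `∞`
when no such `N` exists (in particular at `a = 0`). -/
noncomputable def addDivFn {A : Type*} [AddGroup A] (P : Set (AddSubgroup A)) (a : A) : ℕ∞ :=
  sInf {n : ℕ∞ | ∃ N ∈ P, a ∉ N ∧ n = (N.index : ℕ∞)}

/-- The residual finiteness growth function
`RF_{A,P,B_A}(r) = max {D_{A,P}(a) : 0 ≠ a ∈ B_A(r)}` (as a real-valued function,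
taking the value `1` on an empty set of elements). -/
noncomputable def addRF {A : Type*} [AddGroup A] (P : Set (AddSubgroup A)) (S : Finset A)
    (r : ℝ) : ℝ :=
  sSup (insert 1 ((fun a => ((addDivFn P a).toNat : ℝ)) '' (addWordBall S r \ {0})))

/-- `f ⪯ g`: there is `C > 0` with `f(r) ≤ C·g(C·r)` for all `r ≥ max {1, 1/C}`. -/
def GrowthLE (f g : ℝ → ℝ) : Prop :=
  ∃ C : ℝ, 0 < C ∧ ∀ r : ℝ, max 1 (1 / C) ≤ r → f r ≤ C * g (C * r)

/-- `f ≈ g`: `f ⪯ g` and `g ⪯ f`. -/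
def GrowthEquiv (f g : ℝ → ℝ) : Prop :=
  GrowthLE f g ∧ GrowthLE g f

/-- The endomorphism of `ℤ^m` given by an integer matrix. -/
def intAct {m : ℕ} (M : Matrix (Fin m) (Fin m) ℤ) : (Fin m → ℤ) →+ (Fin m → ℤ) :=
  M.mulVecLin.toAddMonoidHom

/-- `Inv(φ)`: the finite-index subgroups of `ℤ^m` invariant under the integral
representation `φ : H → GL(m,ℤ)`. -/
def InvSet {H : Type*} [Group H] {m : ℕ}
    (φ : H →* Matrix.GeneralLinearGroup (Fin m) ℤ) : Set (AddSubgroup (Fin m → ℤ)) :=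
  {N | N.FiniteIndex ∧
    ∀ h : H, N.map (intAct ((φ h : Matrix (Fin m) (Fin m) ℤ))) = N}

/-- A `ℂ`-subspace `W ⊆ ℂ^m` is invariant under the (complexified) family of integer
matrices `ρ`. -/
def InvariantC {H : Type*} {m : ℕ} (ρ : H → Matrix (Fin m) (Fin m) ℤ)
    (W : Submodule ℂ (Fin m → ℂ)) : Prop :=
  ∀ h : H, ∀ v ∈ W, ((ρ h).map (Int.cast : ℤ → ℂ)).mulVec v ∈ W

/-- `W` is an irreducible `ℂ`-subrepresentation: nonzero, invariant, and containing
no proper nonzero invariant subspace. -/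
def IsIrredC {H : Type*} {m : ℕ} (ρ : H → Matrix (Fin m) (Fin m) ℤ)
    (W : Submodule ℂ (Fin m → ℂ)) : Prop :=
  W ≠ ⊥ ∧ InvariantC ρ W ∧
    ∀ W' : Submodule ℂ (Fin m → ℂ), W' ≤ W → W' ≠ ⊥ → InvariantC ρ W' → W' = W

/-- The image subgroup `B(ℤ^m) ⊆ ℤ^m` of an integer matrix `B`. -/
def matRange {m : ℕ} (B : Matrix (Fin m) (Fin m) ℤ) : AddSubgroup (Fin m → ℤ) :=
  (intAct B).range

/-- `Com(φ)`: the subgroups in `Inv(φ)` of the form `B(ℤ^m)` for an integer matrix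
`B` with `det B ≠ 0` commuting with every `φ(h)`. -/
def ComSet {H : Type*} [Group H] {m : ℕ}
    (φ : H →* Matrix.GeneralLinearGroup (Fin m) ℤ) : Set (AddSubgroup (Fin m → ℤ)) :=
  {N | N ∈ InvSet φ ∧ ∃ B : Matrix (Fin m) (Fin m) ℤ, B.det ≠ 0 ∧
    (∀ h : H, B * ((φ h : Matrix (Fin m) (Fin m) ℤ)) =
      ((φ h : Matrix (Fin m) (Fin m) ℤ)) * B) ∧
    N = matRange B}

/-- A `ℚ`-subspace `W ⊆ ℚ^m` is invariant under the family of integer matrices `ρ`. -/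
def InvariantQ {H : Type*} {m : ℕ} (ρ : H → Matrix (Fin m) (Fin m) ℤ)
    (W : Submodule ℚ (Fin m → ℚ)) : Prop :=
  ∀ h : H, ∀ v ∈ W, ((ρ h).map (Int.cast : ℤ → ℚ)).mulVec v ∈ W

open Polynomial

theorem mem_matRange {m : ℕ} {B : Matrix (Fin m) (Fin m) ℤ} {v : Fin m → ℤ} :
    v ∈ matRange B ↔ ∃ w, B.mulVec w = v :=
  Iff.rfl

theorem matRange_index {m : ℕ} {B : Matrix (Fin m) (Fin m) ℤ} (hB : B.det ≠ 0) :
    (matRange B).index = B.det.natAbs := by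
  have hinj : Function.Injective B.mulVecLin := Matrix.mulVec_injective_of_det_ne_zero hB
  have h := Submodule.natAbs_det_equiv (LinearMap.range B.mulVecLin)
    (LinearEquiv.ofInjective B.mulVecLin hinj)
  have hcomp : (LinearMap.range B.mulVecLin).subtype ∘ₗ
      AddMonoidHom.toIntLinearMap
        (LinearEquiv.ofInjective B.mulVecLin hinj : (Fin m → ℤ) →+ _) = Matrix.toLin' B := by
    ext v
    simp
  rw [hcomp, LinearMap.det_toLin'] at h
  exact h.symm

theorem commute_aeval_of_commute {R A : Type*} [CommSemiring R] [Semiring A] [Algebra R A]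
    {a b : A} (h : Commute a b) (p : R[X]) : Commute (aeval a p) b := by
  induction p using Polynomial.induction_on' with
  | add p q hp hq => simpa using hp.add_left hq
  | monomial n r =>
    rw [aeval_monomial]
    exact (Algebra.commute_algebraMap_left r b).mul_left (h.pow_left n)

/-- An irreducible factor of the characteristic polynomial takes a singular value at the
matrix. -/
theorem det_aeval_eq_zero_of_dvd_charpoly {n : Type*} [Fintype n] [DecidableEq n]
    (B : Matrix n n ℚ) {g : ℚ[X]} (hg : Irreducible g) (hdvd : g ∣ B.charpoly) :
    (aeval B g).det = 0 := by
  by_contra hdet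
  obtain ⟨z, hz⟩ := IsAlgClosed.exists_root (g.map (algebraMap ℚ ℂ))
    (by simpa using hg.degree_pos.ne')
  let f : Matrix n n ℚ →+* Matrix n n ℂ := (algebraMap ℚ ℂ).mapMatrix
  have hroot : IsRoot (f B).charpoly z := by
    have : (f B).charpoly = B.charpoly.map (algebraMap ℚ ℂ) := Matrix.charpoly_map B _
    rw [this]
    exact hz.dvd (Polynomial.map_dvd _ hdvd)
  have hspec := spectrum.subset_polynomial_aeval (f B) (g.map (algebraMap ℚ ℂ))
    ⟨z, Matrix.mem_spectrum_iff_isRoot_charpoly.mpr hroot, rfl⟩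
  simp only [hz.eq_zero] at hspec
  rw [spectrum.zero_mem_iff, ← map_aeval_eq_aeval_map (S := Matrix n n ℚ) (ψ := f)] at hspec
  · exact hspec (((Matrix.isUnit_iff_isUnit_det _).mpr (isUnit_iff_ne_zero.mpr hdet)).map f)
  · ext; simp [f, Matrix.algebraMap_matrix_apply]

theorem Polynomial.Monic.eq_pow_of_irreducible_dvd {K : Type*} [Field K] {f p : K[X]}
    (hf : f.Monic) (hp : p.Monic) (hpi : Irreducible p)
    (h : ∀ g, Irreducible g → g ∣ f → p ∣ g) : ∃ a : ℕ, f = p ^ a := by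
  obtain ⟨a, s, hs, hfs⟩ := WfDvdMonoid.max_power_factor hf.ne_zero hpi
  have hsu : IsUnit s := by
    by_contra hsu
    obtain ⟨g, hg, hgs⟩ := WfDvdMonoid.exists_irreducible_factor hsu
      (by rintro rfl; simp at hs)
    exact hs ((h g hg (hfs ▸ hgs.mul_left _)).trans hgs)
  have hsm : s.Monic := (hp.pow a).of_mul_monic_left (hfs ▸ hf)
  exact ⟨a, by rw [hfs, hsm.isUnit_iff.mp hsu, mul_one]⟩

theorem exists_isIrredC_le {H : Type*} {m : ℕ} (ρ : H → Matrix (Fin m) (Fin m) ℤ)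
    {E : Submodule ℂ (Fin m → ℂ)} (hE : E ≠ ⊥) (hinv : InvariantC ρ E) :
    ∃ W ≤ E, IsIrredC ρ W := by
  obtain ⟨W, ⟨hWE, hW, hWinv⟩, hmin⟩ := WellFounded.has_min
    (wellFounded_lt (α := Submodule ℂ (Fin m → ℂ)))
    {W | W ≤ E ∧ W ≠ ⊥ ∧ InvariantC ρ W} ⟨E, le_rfl, hE, hinv⟩
  refine ⟨W, hWE, hW, hWinv, fun W' hle hne hinv' => ?_⟩
  exact hle.eq_of_not_lt (hmin W' ⟨hle.trans hWE, hne, hinv'⟩)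

theorem addWordBall_finite {A : Type*} [AddGroup A] (S : Finset A) (r : ℝ) :
    (addWordBall S r).Finite := by
  let T : Set A := {x | x ∈ S ∨ -x ∈ S}
  have hT : T.Finite := by
    refine (S.finite_toSet.union (S.finite_toSet.image Neg.neg)).subset ?_
    rintro x (hx | hx)
    · exact Or.inl hx
    · exact Or.inr ⟨-x, hx, neg_neg x⟩
  have : Finite T := hT
  refine ((List.finite_length_le T ⌊r⌋₊).image fun l => (l.map Subtype.val).sum).subset ?_
  rintro a ⟨l, hl, hlen, rfl⟩
  refine ⟨l.attach.map fun x => ⟨x.1, hl x.1 x.2⟩, ?_, ?_⟩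
  · simpa using Nat.le_floor hlen
  · simp

theorem nsmul_mem_addWordBall {A : Type*} [AddGroup A] {S : Finset A} {e : A} (he : e ∈ S)
    {n : ℕ} {r : ℝ} (h : (n : ℝ) ≤ r) : n • e ∈ addWordBall S r :=
  ⟨List.replicate n e, fun x hx => Or.inl (List.eq_of_mem_replicate hx ▸ he), by simpa using h,
    by simp⟩

theorem addDivFn_toNat_le_addRF {A : Type*} [AddGroup A] (P : Set (AddSubgroup A))
    {S : Finset A} {r : ℝ} {a : A} (ha : a ∈ addWordBall S r) (h0 : a ≠ 0) :
    ((addDivFn P a).toNat : ℝ) ≤ addRF P S r :=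
  le_csSup ((((addWordBall_finite S r).sdiff).image _).insert 1).bddAbove
    (Or.inr ⟨a, ⟨ha, h0⟩, rfl⟩)

theorem le_addDivFn_toNat {A : Type*} [AddGroup A] {P : Set (AddSubgroup A)} {a : A} {n : ℕ}
    (hex : ∃ N ∈ P, a ∉ N) (h : ∀ N ∈ P, a ∉ N → n ≤ N.index) :
    n ≤ (addDivFn P a).toNat := by
  have hle : (n : ℕ∞) ≤ addDivFn P a := by
    refine le_sInf ?_
    rintro _ ⟨N, hN, haN, rfl⟩
    exact_mod_cast h N hN haN
  have hne : addDivFn P a ≠ ⊤ := by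
    obtain ⟨N, hN, haN⟩ := hex
    exact ne_top_of_le_ne_top (ENat.natCast_ne_top N.index) (sInf_le ⟨N, hN, haN, rfl⟩)
  simpa using ENat.toNat_le_toNat hle hne

theorem lcmUpto_le_exp (n : ℕ) :
    (Nat.lcmUpto n : ℝ) ≤ Real.exp ((Real.log 4 + 4) * n) := by
  rw [← Real.log_le_iff_le_exp (by exact_mod_cast Nat.lcmUpto_pos n),
    ← Chebyshev.psi_eq_log_lcmUpto]
  exact Chebyshev.psi_le_const_mul_self n.cast_nonneg

theorem dvd_lcmUpto {d n : ℕ} (hd : d ≠ 0) (h : d ≤ n) : d ∣ Nat.lcmUpto n :=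
  Finset.dvd_lcm (f := id) (Finset.mem_Icc.mpr ⟨Nat.one_le_iff_ne_zero.mpr hd, h⟩)

theorem coeff_zero_smul_mem_matRange {m : ℕ} {B : Matrix (Fin m) (Fin m) ℤ} {q : ℤ[X]}
    (hq : aeval B q = 0) (v : Fin m → ℤ) : q.coeff 0 • v ∈ matRange B := by
  refine mem_matRange.mpr ⟨(aeval B q.divX).mulVec (-v), ?_⟩
  have h : B * aeval B q.divX = -(q.coeff 0 • 1) := by
    rw [← X_mul_divX_add q] at hq
    simp only [map_add, map_mul, aeval_X, aeval_C, Algebra.algebraMap_eq_smul_one] at hq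
    exact eq_neg_of_add_eq_zero_left hq
  rw [Matrix.mulVec_mulVec, h, Matrix.neg_mulVec_neg, Matrix.smul_mulVec, Matrix.one_mulVec]

theorem natAbs_det_eq_of_charpoly_eq_pow {m : ℕ} {B : Matrix (Fin m) (Fin m) ℤ} {q : ℤ[X]}
    {a : ℕ} (h : B.charpoly = q ^ a) : B.det.natAbs = (q.coeff 0).natAbs ^ a := by
  rw [Matrix.det_eq_sign_charpoly_coeff, h, coeff_zero_eq_eval_zero, eval_pow,
    ← coeff_zero_eq_eval_zero, Int.natAbs_mul, Int.natAbs_pow, Int.natAbs_pow]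
  simp

/-- A complex eigenspace of a matrix commuting with `ρ` contains an irreducible
subrepresentation, so it bounds the multiplicity of the eigenvalue from below. -/
theorem le_rootMultiplicity_charpoly {H : Type*} {m : ℕ} {ρ : H → Matrix (Fin m) (Fin m) ℤ}
    {k : ℕ} (hk : ∀ W : Submodule ℂ (Fin m → ℂ), IsIrredC ρ W → Module.finrank ℂ W = k)
    {B : Matrix (Fin m) (Fin m) ℤ} (hB : ∀ h, Commute B (ρ h)) {z : ℂ}
    (hz : (B.map (Int.cast : ℤ → ℂ)).charpoly.IsRoot z) :
    k ≤ (B.map (Int.cast : ℤ → ℂ)).charpoly.rootMultiplicity z := by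
  set M := B.map (Int.cast : ℤ → ℂ)
  have hcharpoly : (Matrix.toLin' M).charpoly = M.charpoly := Matrix.charpoly_toLin' M
  have hE : Module.End.eigenspace (Matrix.toLin' M) z ≠ ⊥ := by
    rw [← hcharpoly, ← Module.End.hasEigenvalue_iff_isRoot_charpoly] at hz
    exact hz
  have hinv : InvariantC ρ (Module.End.eigenspace (Matrix.toLin' M) z) := by
    intro h v hv
    rw [Module.End.mem_eigenspace_iff, Matrix.toLin'_apply] at hv ⊢
    have hcomm : M * (ρ h).map (Int.cast : ℤ → ℂ) = (ρ h).map (Int.cast : ℤ → ℂ) * M :=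
      ((hB h).map (Int.castRingHom ℂ).mapMatrix).eq
    rw [Matrix.mulVec_mulVec, hcomm, ← Matrix.mulVec_mulVec, hv, Matrix.mulVec_smul]
  obtain ⟨W, hWE, hW⟩ := exists_isIrredC_le ρ hE hinv
  rw [← hk W hW, ← hcharpoly]
  exact (Submodule.finrank_mono hWE).trans (LinearMap.finrank_eigenspace_le _ z)

theorem aeval_eq_zero_of_irreducible_dvd_charpoly {H : Type*} {m : ℕ}
    {ρ : H → Matrix (Fin m) (Fin m) ℤ}
    (hirr : ∀ W : Submodule ℚ (Fin m → ℚ), InvariantQ ρ W → W = ⊥ ∨ W = ⊤)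
    {B : Matrix (Fin m) (Fin m) ℤ} (hB : ∀ h, Commute B (ρ h)) {g : ℚ[X]}
    (hg : Irreducible g) (hdvd : g ∣ (B.map (Int.cast : ℤ → ℚ)).charpoly) :
    aeval (B.map (Int.cast : ℤ → ℚ)) g = 0 := by
  set M := B.map (Int.cast : ℤ → ℚ)
  obtain ⟨v, hv0, hv⟩ := Matrix.exists_mulVec_eq_zero_iff.mpr
    (det_aeval_eq_zero_of_dvd_charpoly M hg hdvd)
  have hinv : InvariantQ ρ (LinearMap.ker (Matrix.toLin' (aeval M g))) := by
    intro h w hw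
    rw [LinearMap.mem_ker, Matrix.toLin'_apply] at hw ⊢
    have hcomm : Commute M ((ρ h).map (Int.cast : ℤ → ℚ)) :=
      (hB h).map (Int.castRingHom ℚ).mapMatrix
    rw [Matrix.mulVec_mulVec, (commute_aeval_of_commute hcomm g).eq, ← Matrix.mulVec_mulVec, hw,
      Matrix.mulVec_zero]
  rcases hirr _ hinv with h | h
  · exact absurd ((Submodule.mem_bot ℚ).mp (h ▸ LinearMap.mem_ker.mpr hv)) hv0
  · exact (LinearEquiv.map_eq_zero_iff _).mp (LinearMap.ker_eq_top.mp h)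

/-- The characteristic polynomial of a matrix commuting with a rationally irreducible
representation is a power, with exponent at least `k`, of an integral polynomial annihilating
the matrix. -/
theorem exists_charpoly_eq_pow {H : Type*} {m : ℕ} (hm : 0 < m)
    {ρ : H → Matrix (Fin m) (Fin m) ℤ}
    (hirr : ∀ W : Submodule ℚ (Fin m → ℚ), InvariantQ ρ W → W = ⊥ ∨ W = ⊤)
    {k : ℕ} (hk : ∀ W : Submodule ℂ (Fin m → ℂ), IsIrredC ρ W → Module.finrank ℂ W = k)
    {B : Matrix (Fin m) (Fin m) ℤ} (hB : ∀ h, Commute B (ρ h)) :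
    ∃ q : ℤ[X], ∃ a : ℕ, k ≤ a ∧ aeval B q = 0 ∧ B.charpoly = q ^ a := by
  have : NeZero m := ⟨hm.ne'⟩
  let f : Matrix (Fin m) (Fin m) ℤ →+* Matrix (Fin m) (Fin m) ℚ :=
    (algebraMap ℤ ℚ).mapMatrix
  have hf : Function.Injective f := Matrix.map_injective (algebraMap ℤ ℚ).injective_int
  have hfB : (f B).charpoly = B.charpoly.map (algebraMap ℤ ℚ) := Matrix.charpoly_map B _
  have hann : ∀ g : ℚ[X], Irreducible g → g ∣ (f B).charpoly → minpoly ℚ (f B) ∣ g :=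
    fun g hg hdvd => minpoly.dvd _ _ (aeval_eq_zero_of_irreducible_dvd_charpoly hirr hB hg hdvd)
  have hint : IsIntegral ℚ (f B) := Algebra.IsIntegral.isIntegral _
  have hmonic := minpoly.monic hint
  have hdvd := Matrix.minpoly_dvd_charpoly (f B)
  have hpirr : Irreducible (minpoly ℚ (f B)) := by
    obtain ⟨g, hg, hgp⟩ := WfDvdMonoid.exists_irreducible_factor (minpoly.not_isUnit ℚ (f B))
      hmonic.ne_zero
    exact (associated_of_dvd_dvd (hann g hg (hgp.trans hdvd)) hgp).symm.irreducible hg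
  obtain ⟨a, ha⟩ := (Matrix.charpoly_monic (f B)).eq_pow_of_irreducible_dvd hmonic hpirr hann
  obtain ⟨q, hq⟩ := IsIntegrallyClosed.eq_map_mul_C_of_dvd ℚ (Matrix.charpoly_monic B)
    (hfB ▸ hdvd)
  rw [hmonic.leadingCoeff, C_1, mul_one] at hq
  refine ⟨q, a, ?_, ?_, ?_⟩
  · obtain ⟨z, hz⟩ := IsAlgClosed.exists_root ((minpoly ℚ (f B)).map (algebraMap ℚ ℂ))
      (by simpa using hpirr.degree_pos.ne')
    have hcharC : (B.map (Int.cast : ℤ → ℂ)).charpoly =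
        (minpoly ℚ (f B)).map (algebraMap ℚ ℂ) ^ a := by
      rw [← Polynomial.map_pow, ← ha, hfB, Polynomial.map_map]
      exact Matrix.charpoly_map B (Int.castRingHom ℂ)
    have ha0 : a ≠ 0 := by
      rintro rfl
      have := Matrix.charpoly_natDegree_eq_dim (f B)
      simp [ha] at this
      omega
    have hle := le_rootMultiplicity_charpoly hk hB (z := z)
      (hcharC ▸ hz.dvd (dvd_pow_self _ ha0))
    have hsep := (hpirr.separable.map (f := algebraMap ℚ ℂ))
    have h1 := rootMultiplicity_le_one_of_separable hsep z
    rw [hcharC, ← count_roots, roots_pow, Multiset.count_nsmul, count_roots] at hle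
    exact hle.trans (by simpa using Nat.mul_le_mul_left a h1)
  · apply hf
    rw [map_zero, map_aeval_eq_aeval_map (φ := algebraMap ℤ ℚ) (by ext; simp), hq,
      minpoly.aeval]
  · apply map_injective _ (algebraMap ℤ ℚ).injective_int
    rw [Polynomial.map_pow, hq, ← hfB, ha]

theorem pow_le_index_of_notMem {H : Type*} [Group H] {m : ℕ} (hm : 0 < m)
    {φ : H →* Matrix.GeneralLinearGroup (Fin m) ℤ}
    (hirr : ∀ W : Submodule ℚ (Fin m → ℚ),
      InvariantQ (fun h => (φ h : Matrix (Fin m) (Fin m) ℤ)) W → W = ⊥ ∨ W = ⊤)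
    {k : ℕ} (hk : ∀ W : Submodule ℂ (Fin m → ℂ),
      IsIrredC (fun h => (φ h : Matrix (Fin m) (Fin m) ℤ)) W → Module.finrank ℂ W = k)
    {N : AddSubgroup (Fin m → ℤ)} (hN : N ∈ ComSet φ) {e : Fin m → ℤ} {n : ℕ}
    (he : Nat.lcmUpto n • e ∉ N) : (n + 1) ^ k ≤ N.index := by
  obtain ⟨-, B, hdet, hcomm, rfl⟩ := hN
  obtain ⟨q, a, hka, hq, hchar⟩ := exists_charpoly_eq_pow hm hirr hk hcomm
  have hdet' := natAbs_det_eq_of_charpoly_eq_pow hchar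
  have hlt : n < (q.coeff 0).natAbs := by
    by_contra! hle
    by_cases h0 : q.coeff 0 = 0
    · have ha : a ≠ 0 := by
        rintro rfl
        have := Matrix.charpoly_natDegree_eq_dim B
        simp [hchar] at this
        omega
      rw [h0, Int.natAbs_zero, zero_pow ha, Int.natAbs_eq_zero] at hdet'
      exact hdet hdet'
    · obtain ⟨c, hc⟩ := Int.natAbs_dvd.mp
        (Int.natCast_dvd_natCast.mpr (dvd_lcmUpto (Int.natAbs_ne_zero.mpr h0) hle))
      apply he
      rw [← natCast_zsmul, hc, mul_smul]
      exact coeff_zero_smul_mem_matRange hq _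
  rw [matRange_index hdet, hdet']
  calc (n + 1) ^ k ≤ (n + 1) ^ a := Nat.pow_le_pow_right n.succ_pos hka
    _ ≤ _ := Nat.pow_le_pow_left hlt a

theorem matRange_smul_one_mem_comSet {H : Type*} [Group H] {m : ℕ}
    (φ : H →* Matrix.GeneralLinearGroup (Fin m) ℤ) {c : ℤ} (hc : c ≠ 0) :
    matRange (c • (1 : Matrix (Fin m) (Fin m) ℤ)) ∈ ComSet φ := by
  have hdet : (c • (1 : Matrix (Fin m) (Fin m) ℤ)).det ≠ 0 := by
    rw [Matrix.det_smul, Matrix.det_one, mul_one]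
    exact pow_ne_zero _ hc
  have hle : ∀ h : H, (matRange (c • (1 : Matrix (Fin m) (Fin m) ℤ))).map
      (intAct (φ h : Matrix (Fin m) (Fin m) ℤ)) ≤ matRange (c • 1) := by
    rintro h _ ⟨_, ⟨w, rfl⟩, rfl⟩
    refine mem_matRange.mpr ⟨(φ h : Matrix (Fin m) (Fin m) ℤ).mulVec w, ?_⟩
    change _ = (φ h : Matrix (Fin m) (Fin m) ℤ).mulVec ((c • 1 : Matrix _ _ ℤ).mulVec w)
    rw [Matrix.smul_mulVec, Matrix.one_mulVec, Matrix.smul_mulVec, Matrix.one_mulVec,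
      Matrix.mulVec_smul]
  refine ⟨⟨⟨?_⟩, fun h => (hle h).antisymm fun v hv => ?_⟩, c • 1, hdet,
    fun h => by rw [smul_one_mul, mul_smul_one], rfl⟩
  · rw [matRange_index hdet]
    exact Int.natAbs_ne_zero.mpr hdet
  · refine ⟨_, hle h⁻¹ ⟨v, hv, rfl⟩, ?_⟩
    have : (φ h : Matrix (Fin m) (Fin m) ℤ) * (φ h⁻¹ : Matrix (Fin m) (Fin m) ℤ) = 1 := by
      rw [← Units.val_mul, ← map_mul, mul_inv_cancel, map_one, Units.val_one]
    simp [intAct, -map_inv, -Matrix.coe_units_inv, this]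

theorem exists_mem_comSet_notMem {H : Type*} [Group H] {m : ℕ}
    (φ : H →* Matrix.GeneralLinearGroup (Fin m) ℤ) {v : Fin m → ℤ} (hv : v ≠ 0) :
    ∃ N ∈ ComSet φ, v ∉ N := by
  obtain ⟨i, hi⟩ := Function.ne_iff.mp hv
  refine ⟨_, matRange_smul_one_mem_comSet φ (mul_ne_zero two_ne_zero hi), fun hmem => ?_⟩
  obtain ⟨w, hw⟩ := mem_matRange.mp hmem
  have hwi := congrFun hw i
  simp only [Matrix.smul_mulVec, Matrix.one_mulVec, Pi.smul_apply, smul_eq_mul] at hwi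
  have h1 : 2 * w i = 1 := mul_left_cancel₀ hi (by linear_combination hwi)
  omega

/-- if `φ : H → GL(m,ℤ)` is irreducible over `ℚ` and its absolutely
irreducible subrepresentations over `ℂ` have dimension `k`, then
`log^k ⪯ RF_{ℤ^m, Com(φ)}`. -/
theorem stmt_18 {H : Type*} [Group H] [Fintype H] {m : ℕ}
    (φ : H →* Matrix.GeneralLinearGroup (Fin m) ℤ)
    (S : Finset (Fin m → ℤ)) (hS : AddSubgroup.closure (S : Set (Fin m → ℤ)) = ⊤)
    (hQirr : ∀ W : Submodule ℚ (Fin m → ℚ),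
      InvariantQ (fun h => (φ h : Matrix (Fin m) (Fin m) ℤ)) W → W = ⊥ ∨ W = ⊤)
    (k : ℕ)
    (hk : ∀ W : Submodule ℂ (Fin m → ℂ),
      IsIrredC (fun h => (φ h : Matrix (Fin m) (Fin m) ℤ)) W → Module.finrank ℂ W = k)
    (hex : ∃ W : Submodule ℂ (Fin m → ℂ),
      IsIrredC (fun h => (φ h : Matrix (Fin m) (Fin m) ℤ)) W) :
    GrowthLE (fun r => (Real.log r) ^ k) (addRF (ComSet φ) S) := by
  have hm : 0 < m := by
    obtain ⟨W, hW, -⟩ := hex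
    by_contra! h
    obtain rfl : m = 0 := by omega
    exact hW (Subsingleton.elim _ _)
  have : NeZero m := ⟨hm.ne'⟩
  obtain ⟨e, heS, he⟩ : ∃ e ∈ S, e ≠ 0 := by
    by_contra! h
    have hbot : AddSubgroup.closure (S : Set (Fin m → ℤ)) = ⊥ :=
      (AddSubgroup.closure_eq_bot_iff).mpr h
    exact bot_ne_top (hbot.symm.trans hS)
  set A : ℝ := Real.log 4 + 4
  have hA : 0 < A := by positivity
  refine ⟨max 1 (A ^ k), by positivity, fun r hr => ?_⟩
  have hr1 : 1 ≤ r := (le_max_left _ _).trans hr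
  have hlog : 0 ≤ Real.log r := Real.log_nonneg hr1
  set n := ⌊Real.log r / A⌋₊
  set C := max 1 (A ^ k)
  have hlcm : (Nat.lcmUpto n : ℝ) ≤ C * r := by
    have hn : A * n ≤ Real.log r := by
      rw [mul_comm, ← le_div_iff₀ hA]
      exact Nat.floor_le (by positivity)
    calc (Nat.lcmUpto n : ℝ) ≤ Real.exp (A * n) := lcmUpto_le_exp n
      _ ≤ r := by rwa [← Real.le_log_iff_exp_le (by linarith)]
      _ ≤ C * r := le_mul_of_one_le_left (by linarith) (le_max_left _ _)
  have hne : Nat.lcmUpto n • e ≠ 0 := smul_ne_zero (Nat.lcmUpto_ne_zero n) he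
  have hRF : ((n + 1 : ℕ) : ℝ) ^ k ≤ addRF (ComSet φ) S (C * r) := by
    refine le_trans ?_ (addDivFn_toNat_le_addRF _ (nsmul_mem_addWordBall heS hlcm) hne)
    exact_mod_cast le_addDivFn_toNat (exists_mem_comSet_notMem φ hne)
      fun N hN hmem => pow_le_index_of_notMem hm hQirr hk hN hmem
  calc Real.log r ^ k = A ^ k * (Real.log r / A) ^ k := by
        rw [← mul_pow, mul_div_cancel₀ _ hA.ne']
    _ ≤ C * ((n + 1 : ℕ) : ℝ) ^ k := by
        gcongr
        · exact le_max_right _ _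
        · exact_mod_cast (Nat.lt_floor_add_one (Real.log r / A)).le
    _ ≤ C * addRF (ComSet φ) S (C * r) := by gcongr
end

section
/- For every m ≥ 1 and every 1 ≤ k ≤ m, there exist a finite group H and a homomorphism φ : H → GL(m,ℤ) such that the semidirect product G = ℤ^m ⋊_φ H satisfies RF_{G,ν(G),B_G} ≈ log^k for any finite generating set of G. In particular, for every k ∈ ℕ there exists a finitely generated residually finite group G with RF_{G,ν(G),B_G} ≈ log^k. -/
/-- The word ball of radius `r` in a group `G` with respect to a finite (generating)
set `S`: products of at most `r` elements of `S ∪ S⁻¹`. -/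
def wordBall {G : Type*} [Group G] (S : Finset G) (r : ℝ) : Set G :=
  {g | ∃ l : List G, (∀ x ∈ l, x ∈ S ∨ x⁻¹ ∈ S) ∧ (l.length : ℝ) ≤ r ∧ l.prod = g}

/-- `ν(G)`: the set of finite-index normal subgroups of `G`. -/
def nu (G : Type*) [Group G] : Set (Subgroup G) :=
  {N | N.Normal ∧ N.FiniteIndex}

/-- The divisibility function `D_{G,P}(g) = min {[G:N] : N ∈ P, g ∉ N}`, with value `∞`
when no such `N` exists (in particular at `g = 1`). -/
noncomputable def divFn {G : Type*} [Group G] (P : Set (Subgroup G)) (g : G) : ℕ∞ :=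
  sInf {n : ℕ∞ | ∃ N ∈ P, g ∉ N ∧ n = (N.index : ℕ∞)}

/-- The residual finiteness growth function
`RF_{G,P,B_G}(r) = max {D_{G,P}(g) : 1 ≠ g ∈ B_G(r)}` (as a real-valued function,
taking the value `1` on an empty set of elements). -/
noncomputable def RFgrowth {G : Type*} [Group G] (P : Set (Subgroup G)) (S : Finset G)
    (r : ℝ) : ℝ :=
  sSup (insert 1 ((fun g => ((divFn P g).toNat : ℝ)) '' (wordBall S r \ {1})))

open Multiplicative SemidirectProduct

/-- The vector action underlying an action on `Multiplicative (Fin m → ℤ)`. -/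
def actVec {m : ℕ} {H : Type} [Group H] (act : H →* MulAut (Multiplicative (Fin m → ℤ)))
    (h : H) : (Fin m → ℤ) →+ (Fin m → ℤ) :=
  MonoidHom.toAdditiveRight ((act h).toMonoidHom)

section LatticeExtension

variable {m : ℕ} {H : Type} [Group H] {act : H →* MulAut (Multiplicative (Fin m → ℤ))}

theorem actVec_apply (h : H) (v : Fin m → ℤ) :
    actVec act h v = toAdd (act h (ofAdd v)) := rfl

theorem actVec_one (v : Fin m → ℤ) : actVec act 1 v = v := by
  simp [actVec_apply]

theorem actVec_mul (g h : H) (v : Fin m → ℤ) :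
    actVec act (g * h) v = actVec act g (actVec act h v) := by
  simp [actVec_apply]

theorem toAdd_mul_left (a b : Multiplicative (Fin m → ℤ) ⋊[act] H) :
    toAdd (a * b).left = toAdd a.left + actVec act a.right (toAdd b.left) := rfl

theorem toAdd_inv_left (a : Multiplicative (Fin m → ℤ) ⋊[act] H) :
    toAdd (a⁻¹).left = - actVec act a.right⁻¹ (toAdd a.left) := by
  rw [← map_neg]; rfl

/-- A set of coordinates is invariant if, for every `d`, the vectors whose coordinates in the
set are divisible by `d` form an invariant set. -/
def IsInvariantBlock (act : H →* MulAut (Multiplicative (Fin m → ℤ))) (T : Finset (Fin m)) :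
    Prop :=
  ∀ (h : H) (d : ℤ) (w : Fin m → ℤ), (∀ i ∈ T, d ∣ w i) → ∀ i ∈ T, d ∣ actVec act h w i

/-- The translations whose coordinates in `T` are divisible by `d`. -/
def congruenceSubgroup (T : Finset (Fin m)) (hT : IsInvariantBlock act T) (d : ℤ) :
    Subgroup (Multiplicative (Fin m → ℤ) ⋊[act] H) where
  carrier := {g | g.right = 1 ∧ ∀ i ∈ T, d ∣ toAdd g.left i}
  mul_mem' := by
    rintro a b ⟨ha, ha'⟩ ⟨hb, hb'⟩
    refine ⟨by simp [ha, hb], fun i hi => ?_⟩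
    rw [toAdd_mul_left]
    exact dvd_add (ha' i hi) (hT _ _ _ hb' i hi)
  one_mem' := ⟨rfl, fun i _ => dvd_zero d⟩
  inv_mem' := by
    rintro a ⟨ha, ha'⟩
    refine ⟨by simp [ha], fun i hi => ?_⟩
    rw [toAdd_inv_left]
    exact (dvd_neg.2 (hT _ _ _ ha' i hi))

theorem congruenceSubgroup_normal (T : Finset (Fin m)) (hT : IsInvariantBlock act T) (d : ℤ) :
    (congruenceSubgroup T hT d).Normal := by
  refine ⟨fun n ⟨hn, hn'⟩ g => ⟨by simp [hn], fun i hi => ?_⟩⟩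
  have h : toAdd (g * n * g⁻¹).left = actVec act g.right (toAdd n.left) := by
    rw [toAdd_mul_left, toAdd_mul_left, toAdd_inv_left, map_neg, ← actVec_mul, mul_right, hn,
      mul_one, mul_inv_cancel, actVec_one]
    abel
  rw [h]
  exact hT _ _ _ hn' i hi

theorem Subgroup.finiteIndex_and_index_le_of_map {G X : Type*} [Group G] [Finite X]
    (N : Subgroup G) (f : G → X) (hf : ∀ a b, f a = f b → a⁻¹ * b ∈ N) :
    N.FiniteIndex ∧ N.index ≤ Nat.card X := by
  have hinj : Function.Injective (fun q : G ⧸ N => f q.out) := fun q q' h => by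
    rw [← q.out_eq', ← q'.out_eq']
    exact QuotientGroup.eq.2 (hf _ _ h)
  have : Finite (G ⧸ N) := Finite.of_injective _ hinj
  exact ⟨Subgroup.finiteIndex_of_finite_quotient, Nat.card_le_card_of_injective _ hinj⟩

theorem congruenceSubgroup_index_le [Finite H] (T : Finset (Fin m))
    (hT : IsInvariantBlock act T) (d : ℕ) (hd : 0 < d) :
    (congruenceSubgroup T hT d).FiniteIndex ∧
      (congruenceSubgroup T hT d).index ≤ d ^ T.card * Nat.card H := by
  have : NeZero d := ⟨hd.ne'⟩
  have key := Subgroup.finiteIndex_and_index_le_of_map (congruenceSubgroup T hT (d : ℤ))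
    (fun g => ((fun i : T => ((toAdd g.left i.1 : ℤ) : ZMod d)), g.right)) (by
      intro a b hab
      obtain ⟨h₁, h₂⟩ := Prod.mk.inj hab
      refine ⟨by simp [h₂], ?_⟩
      rw [toAdd_mul_left, toAdd_inv_left, inv_right, neg_add_eq_sub, ← map_sub]
      refine hT _ _ _ fun i hi => ?_
      exact (ZMod.intCast_eq_intCast_iff_dvd_sub _ _ d).1 (congrFun h₁ ⟨i, hi⟩))
  simpa [Nat.card_prod, Nat.card_fun] using key

theorem congruenceSubgroup_mem_nu [Finite H] (T : Finset (Fin m))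
    (hT : IsInvariantBlock act T) (d : ℕ) (hd : 0 < d) :
    congruenceSubgroup T hT d ∈ nu (Multiplicative (Fin m → ℤ) ⋊[act] H) :=
  ⟨congruenceSubgroup_normal T hT d, (congruenceSubgroup_index_le T hT d hd).1⟩

end LatticeExtension

theorem exists_not_dvd_le_log (a : ℤ) (ha : a ≠ 0) :
    ∃ d : ℕ, 0 < d ∧ ¬ (d : ℤ) ∣ a ∧ (d : ℝ) ≤ 4 * Real.log |(a : ℝ)| + 6 := by
  set N := a.natAbs with hN
  have hN0 : N ≠ 0 := by simpa [hN] using ha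
  set t := Nat.log 2 N + 3 with ht
  have hlt : Nat.lcmUpto (2 * t) > N := by
    have h1 := Chebyshev.two_pow_le_mul_lcmUpto (2 * t)
    have h2 : N < 2 ^ t := (Nat.lt_pow_succ_log_self one_lt_two N).trans_le
      (Nat.pow_le_pow_right two_pos (by omega))
    have h3 : ∀ s : ℕ, 2 * (s + 3) + 1 ≤ 2 ^ (s + 3) := by
      intro s
      induction s with
      | zero => norm_num
      | succ s ih => rw [show s + 1 + 3 = (s + 3) + 1 by ring, pow_succ]; omega
    have h4 : 2 * t + 1 ≤ 2 ^ t := h3 _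
    rw [two_mul, pow_add, ← two_mul] at h1
    by_contra! h
    have : 2 ^ t * 2 ^ t < 2 ^ t * 2 ^ t :=
      calc 2 ^ t * 2 ^ t ≤ (2 * t + 1) * Nat.lcmUpto (2 * t) := h1
        _ ≤ 2 ^ t * N := Nat.mul_le_mul h4 h
        _ < _ := Nat.mul_lt_mul_of_pos_left h2 (by positivity)
    exact this.false
  obtain ⟨d, hd, hnd⟩ : ∃ d ∈ Finset.Icc 1 (2 * t), ¬ d ∣ N := by
    by_contra! h
    exact hlt.not_ge (Nat.le_of_dvd (Nat.pos_of_ne_zero hN0) (Finset.lcm_dvd h))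
  rw [Finset.mem_Icc] at hd
  refine ⟨d, hd.1, fun h => hnd (Int.natCast_dvd.1 h), ?_⟩
  have hlog : (Nat.log 2 N : ℝ) ≤ 2 * Real.log N := by
    have h1 : ((2 : ℝ) ^ Nat.log 2 N) ≤ N := by exact_mod_cast Nat.pow_log_le_self 2 hN0
    have h2 := Real.log_le_log (by positivity) h1
    rw [Real.log_pow] at h2
    have := Real.log_two_gt_d9
    nlinarith [(Nat.cast_nonneg (Nat.log 2 N) : (0 : ℝ) ≤ _)]
  have habs : |(a : ℝ)| = N := by rw [hN, Nat.cast_natAbs]; simp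
  have hd2 : (d : ℝ) ≤ 2 * (Nat.log 2 N + 3) := by exact_mod_cast hd.2
  rw [habs]
  linarith

theorem exists_divisible_by_all_le (n : ℕ) :
    ∃ L : ℕ, 0 < L ∧ (∀ a : ℤ, a ≠ 0 → |a| ≤ n → a ∣ L) ∧ (L : ℝ) ≤ Real.exp (6 * n) := by
  refine ⟨Nat.lcmUpto n, Nat.lcmUpto_pos n, fun a ha han => ?_, ?_⟩
  · rw [← Int.natAbs_dvd]
    refine Int.natCast_dvd_natCast.2 (Finset.dvd_lcm (f := id) (Finset.mem_Icc.2 ⟨?_, ?_⟩))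
    · exact Int.natAbs_pos.2 ha
    · have : ((a.natAbs : ℕ) : ℤ) ≤ n := by rwa [Int.natCast_natAbs]
      exact_mod_cast this
  · have h0 : (0 : ℝ) < Nat.lcmUpto n := by exact_mod_cast Nat.lcmUpto_pos n
    rw [← Real.log_le_iff_le_exp h0, ← Chebyshev.psi_eq_log_lcmUpto]
    refine (Chebyshev.psi_le_const_mul_self (Nat.cast_nonneg n)).trans ?_
    have : Real.log 4 ≤ 2 := by
      rw [show (4 : ℝ) = 2 ^ 2 by norm_num, Real.log_pow]
      have := Real.log_two_lt_d9
      push_cast; linarith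
    gcongr; linarith

theorem divFn_toNat_le {G : Type*} [Group G] {P : Set (Subgroup G)} {g : G} {N : Subgroup G}
    (hN : N ∈ P) (hg : g ∉ N) : (divFn P g).toNat ≤ N.index :=
  ENat.toNat_le_of_le_natCast (sInf_le ⟨N, hN, hg, rfl⟩)

theorem le_divFn_toNat {G : Type*} [Group G] {P : Set (Subgroup G)} {g : G} {n : ℕ}
    (hex : ∃ N ∈ P, g ∉ N) (h : ∀ N ∈ P, g ∉ N → n ≤ N.index) : n ≤ (divFn P g).toNat := by
  obtain ⟨N, hN, hg⟩ := hex
  have htop : divFn P g ≠ ⊤ := ne_top_of_le_ne_top (ENat.natCast_ne_top N.index)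
    (sInf_le ⟨N, hN, hg, rfl⟩)
  have hle : (n : ℕ∞) ≤ divFn P g := by
    refine le_sInf ?_
    rintro _ ⟨M, hM, hgM, rfl⟩
    exact_mod_cast h M hM hgM
  rwa [← ENat.natCast_toNat htop, Nat.cast_le] at hle

theorem RFgrowth_le {G : Type*} [Group G] {P : Set (Subgroup G)} {S : Finset G} {r B : ℝ}
    (hB : 1 ≤ B) (h : ∀ g ∈ wordBall S r, g ≠ 1 → ∃ N ∈ P, g ∉ N ∧ (N.index : ℝ) ≤ B) :
    RFgrowth P S r ≤ B := by
  refine csSup_le (Set.insert_nonempty _ _) ?_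
  rintro _ (rfl | ⟨g, ⟨hg, hg1⟩, rfl⟩)
  · exact hB
  · obtain ⟨N, hN, hgN, hle⟩ := h g hg hg1
    exact le_trans (Nat.cast_le.2 (divFn_toNat_le hN hgN)) hle

theorem le_RFgrowth {G : Type*} [Group G] {P : Set (Subgroup G)} {S : Finset G} {r B : ℝ}
    (h : ∀ g ∈ wordBall S r, g ≠ 1 → ∃ N ∈ P, g ∉ N ∧ (N.index : ℝ) ≤ B)
    {g : G} (hg : g ∈ wordBall S r) (hg1 : g ≠ 1) {n : ℕ}
    (hn : ∀ N ∈ P, g ∉ N → n ≤ N.index) : (n : ℝ) ≤ RFgrowth P S r := by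
  have hbdd : BddAbove (insert 1 ((fun g => ((divFn P g).toNat : ℝ)) '' (wordBall S r \ {1}))) := by
    refine BddAbove.insert 1 ⟨B, ?_⟩
    rintro _ ⟨x, ⟨hx, hx1⟩, rfl⟩
    obtain ⟨N, hN, hxN, hle⟩ := h x hx hx1
    exact le_trans (Nat.cast_le.2 (divFn_toNat_le hN hxN)) hle
  obtain ⟨N, hN, hgN, -⟩ := h g hg hg1
  refine le_trans ?_ (le_csSup hbdd (Set.mem_insert_of_mem _ ⟨g, ⟨hg, hg1⟩, rfl⟩))
  exact Nat.cast_le.2 (le_divFn_toNat ⟨N, hN, hgN⟩ hn)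

theorem wordBall_mono {G : Type*} [Group G] (S : Finset G) {r s : ℝ} (h : r ≤ s) :
    wordBall S r ⊆ wordBall S s :=
  fun _ ⟨l, hl, hlr, hlg⟩ => ⟨l, hl, hlr.trans h, hlg⟩

theorem exists_mem_wordBall {G : Type*} [Group G] {S : Finset G}
    (hS : Subgroup.closure (S : Set G) = ⊤) (g : G) : ∃ n : ℕ, g ∈ wordBall S n := by
  have hg : g ∈ Submonoid.closure ((S : Set G) ∪ (S : Set G)⁻¹) := by
    rw [← Subgroup.closure_toSubmonoid, hS]; trivial
  obtain ⟨l, hl, hlg⟩ := Submonoid.exists_list_of_mem_closure hg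
  exact ⟨l.length, l, fun x hx => by simpa using hl x hx, le_rfl, hlg⟩

theorem pow_mem_wordBall {G : Type*} [Group G] {S : Finset G} {g : G} {r : ℝ}
    (hg : g ∈ wordBall S r) (n : ℕ) : g ^ n ∈ wordBall S (n * r) := by
  obtain ⟨l, hl, hlr, hlg⟩ := hg
  refine ⟨(List.replicate n l).flatten, fun x hx => ?_, ?_, ?_⟩
  · obtain ⟨l', hl', hx'⟩ := List.mem_flatten.1 hx
    rw [List.eq_of_mem_replicate hl'] at hx'
    exact hl x hx'
  · simp only [List.length_flatten, List.map_replicate, List.sum_replicate, smul_eq_mul,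
      Nat.cast_mul]
    gcongr
  · simp [List.prod_flatten, hlg]

section LatticeExtensionGrowth

variable {m : ℕ} {H : Type} [Group H] {act : H →* MulAut (Multiplicative (Fin m → ℤ))}

theorem exists_coord_bound_of_mem_wordBall [Finite H]
    (S : Finset (Multiplicative (Fin m → ℤ) ⋊[act] H)) :
    ∃ K : ℝ, 1 ≤ K ∧ ∀ r : ℝ, ∀ g ∈ wordBall S r, ∀ i, |((toAdd g.left i : ℤ) : ℝ)| ≤ K * r := by
  have hfin : ((Set.univ : Set H) ×ˢ ((S : Set (Multiplicative (Fin m → ℤ) ⋊[act] H)) ∪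
      (S : Set (Multiplicative (Fin m → ℤ) ⋊[act] H))⁻¹)).Finite :=
    Set.finite_univ.prod (S.finite_toSet.union S.finite_toSet.inv)
  obtain ⟨K, hK⟩ := (hfin.image fun p => ‖actVec act p.1 (toAdd p.2.left)‖).bddAbove
  have hlist : ∀ l : List (Multiplicative (Fin m → ℤ) ⋊[act] H),
      (∀ x ∈ l, x ∈ S ∨ x⁻¹ ∈ S) → ∀ h : H,
        ‖actVec act h (toAdd l.prod.left)‖ ≤ max 1 K * l.length := by
    intro l
    induction l with
    | nil => intro _ h; simp
    | cons x l ih =>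
      intro hl h
      rw [List.prod_cons, toAdd_mul_left, map_add, ← actVec_mul, List.length_cons]
      have hx : ‖actVec act h (toAdd x.left)‖ ≤ K :=
        hK ⟨(h, x), ⟨trivial, by simpa using hl x (by simp)⟩, rfl⟩
      have hl' := ih (fun y hy => hl y (by simp [hy])) (h * x.right)
      calc _ ≤ _ := norm_add_le _ _
        _ ≤ max 1 K + max 1 K * l.length := add_le_add (hx.trans (le_max_right _ _)) hl'
        _ = _ := by push_cast; ring
  refine ⟨max 1 K, le_max_left _ _, ?_⟩
  rintro r _ ⟨l, hl, hlr, rfl⟩ i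
  have h1 := hlist l hl 1
  rw [actVec_one] at h1
  calc |((toAdd l.prod.left i : ℤ) : ℝ)| = ‖toAdd l.prod.left i‖ := (Int.norm_eq_abs _).symm
    _ ≤ ‖toAdd l.prod.left‖ := norm_le_pi_norm _ i
    _ ≤ _ := h1
    _ ≤ _ := by gcongr

theorem exists_separating_of_right_ne_one [Finite H]
    {g : Multiplicative (Fin m → ℤ) ⋊[act] H} (hg : g.right ≠ 1) :
    ∃ N ∈ nu (Multiplicative (Fin m → ℤ) ⋊[act] H), g ∉ N ∧ N.index ≤ Nat.card H := by
  have hT : IsInvariantBlock act ∅ := fun _ _ _ _ i hi => absurd hi (Finset.notMem_empty i)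
  exact ⟨congruenceSubgroup ∅ hT (1 : ℕ), congruenceSubgroup_mem_nu ∅ hT 1 one_pos,
    fun h => hg h.1, by simpa using (congruenceSubgroup_index_le ∅ hT 1 one_pos).2⟩

theorem exists_separating_of_block [Finite H] {k : ℕ}
    {g : Multiplicative (Fin m → ℤ) ⋊[act] H} {i : Fin m} (hi : toAdd g.left i ≠ 0)
    {T : Finset (Fin m)} (hT : IsInvariantBlock act T) (hiT : i ∈ T) (hcard : T.card ≤ k) :
    ∃ N ∈ nu (Multiplicative (Fin m → ℤ) ⋊[act] H), g ∉ N ∧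
      (N.index : ℝ) ≤
        (Nat.card H : ℝ) * (4 * Real.log |((toAdd g.left i : ℤ) : ℝ)| + 6) ^ k := by
  obtain ⟨d, hd, hnd, hle⟩ := exists_not_dvd_le_log _ hi
  refine ⟨congruenceSubgroup T hT d, congruenceSubgroup_mem_nu T hT d hd,
    fun h => hnd (h.2 i hiT), ?_⟩
  have h1 : (congruenceSubgroup T hT d).index ≤ Nat.card H * d ^ k := by
    refine (congruenceSubgroup_index_le T hT d hd).2.trans ?_
    rw [mul_comm]
    exact Nat.mul_le_mul_left _ (Nat.pow_le_pow_right hd hcard)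
  calc ((congruenceSubgroup T hT d).index : ℝ) ≤ (Nat.card H : ℝ) * (d : ℝ) ^ k := by
        exact_mod_cast h1
    _ ≤ _ := by gcongr

theorem exists_separating [Finite H] {k : ℕ}
    (hblocks : ∀ i, ∃ T, IsInvariantBlock act T ∧ i ∈ T ∧ T.card ≤ k)
    (S : Finset (Multiplicative (Fin m → ℤ) ⋊[act] H)) :
    ∃ K : ℝ, 1 ≤ K ∧ ∀ r : ℝ, 1 ≤ r → ∀ g ∈ wordBall S r, g ≠ 1 →
      ∃ N ∈ nu (Multiplicative (Fin m → ℤ) ⋊[act] H), g ∉ N ∧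
        (N.index : ℝ) ≤ (Nat.card H : ℝ) * (4 * Real.log (K * r) + 6) ^ k := by
  obtain ⟨K, hK1, hK⟩ := exists_coord_bound_of_mem_wordBall S
  refine ⟨K, hK1, fun r hr g hg hg1 => ?_⟩
  have hlog : 0 ≤ Real.log (K * r) := Real.log_nonneg (one_le_mul_of_one_le_of_one_le hK1 hr)
  by_cases hright : g.right = 1
  · obtain ⟨i, hi⟩ : ∃ i, toAdd g.left i ≠ 0 := by
      by_contra! h
      exact hg1 (SemidirectProduct.ext (toAdd.injective (funext h)) hright)
    obtain ⟨T, hT, hiT, hcard⟩ := hblocks i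
    obtain ⟨N, hN, hgN, hle⟩ := exists_separating_of_block hi hT hiT hcard
    refine ⟨N, hN, hgN, hle.trans ?_⟩
    have h1 : (1 : ℝ) ≤ |((toAdd g.left i : ℤ) : ℝ)| := by
      exact_mod_cast Int.one_le_abs hi
    have h2 := Real.log_nonneg h1
    have h3 := hK r g hg i
    gcongr
  · obtain ⟨N, hN, hgN, hle⟩ := exists_separating_of_right_ne_one hright
    refine ⟨N, hN, hgN, le_trans (Nat.cast_le.2 hle) ?_⟩
    exact le_mul_of_one_le_right (Nat.cast_nonneg _) (one_le_pow₀ (by linarith))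

theorem growthLE_log_pow [Finite H] {k : ℕ}
    (hblocks : ∀ i, ∃ T, IsInvariantBlock act T ∧ i ∈ T ∧ T.card ≤ k)
    (S : Finset (Multiplicative (Fin m → ℤ) ⋊[act] H)) :
    GrowthLE (RFgrowth (nu (Multiplicative (Fin m → ℤ) ⋊[act] H)) S)
      (fun r => (Real.log r) ^ k) := by
  obtain ⟨K, hK1, hK⟩ := exists_separating hblocks S
  have hcard : (1 : ℝ) ≤ Nat.card H := by exact_mod_cast Nat.card_pos
  set C : ℝ := Nat.card H * 4 ^ k + K * Real.exp (3 / 2) with hC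
  refine ⟨C, by positivity, fun r hr => ?_⟩
  have hr1 : 1 ≤ r := (le_max_left _ _).trans hr
  have hlog : 0 ≤ Real.log (K * r) := Real.log_nonneg (one_le_mul_of_one_le_of_one_le hK1 hr1)
  have hCr : Real.log (K * r) + 3 / 2 ≤ Real.log (C * r) := by
    rw [← Real.log_exp (3 / 2), ← Real.log_mul (by positivity) (by positivity)]
    apply Real.log_le_log (by positivity)
    rw [mul_right_comm]
    gcongr
    rw [hC]
    exact le_add_of_nonneg_left (by positivity)
  refine (RFgrowth_le ?_ (hK r hr1)).trans ?_
  · exact one_le_mul_of_one_le_of_one_le hcard (one_le_pow₀ (by linarith))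
  · calc (Nat.card H : ℝ) * (4 * Real.log (K * r) + 6) ^ k
        ≤ Nat.card H * (4 * Real.log (C * r)) ^ k := by gcongr; linarith
      _ = Nat.card H * 4 ^ k * Real.log (C * r) ^ k := by rw [mul_pow, mul_assoc]
      _ ≤ C * Real.log (C * r) ^ k := by
        have : 0 ≤ Real.log (C * r) := by linarith
        gcongr
        rw [hC]
        exact le_add_of_nonneg_right (by positivity)

theorem inl_actVec_mem_of_normal {N : Subgroup (Multiplicative (Fin m → ℤ) ⋊[act] H)}
    (hN : N.Normal) {v : Fin m → ℤ} (hv : inl (ofAdd v) ∈ N) (h : H) :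
    inl (ofAdd (actVec act h v)) ∈ N := by
  rw [actVec_apply, ofAdd_toAdd, inl_aut, map_inv]
  exact hN.conj_mem _ hv _

/-- Given sign changes and transitivity on a block, a multiple of a basis vector in the block is
only avoided by normal subgroups of large index. -/
theorem pow_card_le_index_of_notMem {T : Finset (Fin m)}
    (hflip : ∀ i ∈ T, ∃ h : H, ∀ w, actVec act h w = w - Pi.single i (2 * w i))
    (hswap : ∀ i ∈ T, ∀ j ∈ T, ∃ h : H, ∀ a, actVec act h (Pi.single i a) = Pi.single j a)
    {n L : ℕ} (hL : ∀ a : ℤ, a ≠ 0 → |a| ≤ n → a ∣ L) {i₀ : Fin m} (hi₀ : i₀ ∈ T)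
    {N : Subgroup (Multiplicative (Fin m → ℤ) ⋊[act] H)}
    (hN : N ∈ nu (Multiplicative (Fin m → ℤ) ⋊[act] H))
    (hnot : inl (ofAdd (Pi.single i₀ (2 * (L : ℤ)))) ∉ N) :
    (n + 1) ^ T.card ≤ N.index := by
  obtain ⟨hnorm, hfin⟩ := hN
  have hcoord : ∀ v : Fin m → ℤ, inl (ofAdd v) ∈ N → ∀ i ∈ T, |v i| ≤ n → v i = 0 := by
    intro v hv i hi hle
    by_contra hne
    obtain ⟨c, hc⟩ := hL _ hne hle
    obtain ⟨h, hh⟩ := hflip i hi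
    obtain ⟨h', hh'⟩ := hswap i hi i₀ hi₀
    have h1 : inl (ofAdd (Pi.single i (2 * v i))) ∈ N := by
      have := N.mul_mem hv (N.inv_mem (inl_actVec_mem_of_normal hnorm hv h))
      rwa [hh, ← map_inv, ← map_mul, ← ofAdd_neg, ← ofAdd_add, neg_sub, add_sub_cancel] at this
    have h2 := inl_actVec_mem_of_normal hnorm h1 h'
    rw [hh'] at h2
    have h3 := N.zpow_mem h2 c
    rw [← map_zpow, ← ofAdd_zsmul, ← Pi.single_smul, smul_eq_mul,
      show c * (2 * v i) = 2 * (L : ℤ) by rw [hc]; ring] at h3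
    exact hnot h3
  let vec : (T → Fin (n + 1)) → Fin m → ℤ := fun x i => if hi : i ∈ T then (x ⟨i, hi⟩ : ℕ) else 0
  let f : (T → Fin (n + 1)) → (Multiplicative (Fin m → ℤ) ⋊[act] H) ⧸ N :=
    fun x => QuotientGroup.mk (inl (ofAdd (vec x)))
  have hf : Function.Injective f := by
    intro x y hxy
    have hmem := QuotientGroup.eq.1 hxy
    rw [← map_inv, ← map_mul, ← ofAdd_neg, ← ofAdd_add] at hmem
    funext ⟨i, hi⟩
    have hval : (-vec x + vec y) i = (y ⟨i, hi⟩ : ℕ) - ((x ⟨i, hi⟩ : ℕ) : ℤ) := by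
      simp [vec, hi]; ring
    have h0 := hcoord _ hmem i hi (by rw [hval, abs_le]; constructor <;> omega)
    rw [hval] at h0
    exact Fin.ext (by omega)
  have := Nat.card_le_card_of_injective f hf
  simpa [Subgroup.index] using this

theorem log_pow_growthLE [Finite H] {T : Finset (Fin m)}
    (hblocks : ∀ i, ∃ T', IsInvariantBlock act T' ∧ i ∈ T' ∧ T'.card ≤ T.card)
    (hflip : ∀ i ∈ T, ∃ h : H, ∀ w, actVec act h w = w - Pi.single i (2 * w i))
    (hswap : ∀ i ∈ T, ∀ j ∈ T, ∃ h : H, ∀ a, actVec act h (Pi.single i a) = Pi.single j a)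
    {i₀ : Fin m} (hi₀ : i₀ ∈ T)
    (S : Finset (Multiplicative (Fin m → ℤ) ⋊[act] H))
    (hS : Subgroup.closure (S : Set (Multiplicative (Fin m → ℤ) ⋊[act] H)) = ⊤) :
    GrowthLE (fun r => (Real.log r) ^ T.card)
      (RFgrowth (nu (Multiplicative (Fin m → ℤ) ⋊[act] H)) S) := by
  obtain ⟨K, hK1, hK⟩ := exists_separating hblocks S
  obtain ⟨R, hR⟩ := exists_mem_wordBall hS (inl (ofAdd (Pi.single i₀ 2)))
  set C : ℝ := 6 ^ T.card + R with hC
  have h6 : (1 : ℝ) ≤ 6 ^ T.card := one_le_pow₀ (by norm_num)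
  have hR0 : (0 : ℝ) ≤ R := Nat.cast_nonneg R
  refine ⟨C, by positivity, fun r hr => ?_⟩
  have hr1 : 1 ≤ r := (le_max_left _ _).trans hr
  have hlog : 0 ≤ Real.log r := Real.log_nonneg hr1
  set n := ⌊Real.log r / 6⌋₊ with hn
  obtain ⟨L, hL0, hL, hLle⟩ := exists_divisible_by_all_le n
  have hLr : (L : ℝ) ≤ r := by
    refine hLle.trans ((Real.le_log_iff_exp_le (by linarith)).1 ?_)
    have := Nat.floor_le (div_nonneg hlog (by norm_num : (0 : ℝ) ≤ 6))
    linarith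
  have hCr : 1 ≤ C * r := one_le_mul_of_one_le_of_one_le (by linarith) hr1
  have hpow : (inl (ofAdd (Pi.single i₀ (2 : ℤ))) : Multiplicative (Fin m → ℤ) ⋊[act] H) ^ L
      = inl (ofAdd (Pi.single i₀ (2 * (L : ℤ)))) := by
    rw [← map_pow, ← ofAdd_nsmul, ← Pi.single_smul, nsmul_eq_mul, mul_comm]
  have hmem : (inl (ofAdd (Pi.single i₀ (2 * (L : ℤ)))) : Multiplicative (Fin m → ℤ) ⋊[act] H)
      ∈ wordBall S (C * r) := by
    rw [← hpow]
    refine wordBall_mono S ?_ (pow_mem_wordBall hR L)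
    rw [mul_comm]
    gcongr
    linarith
  have hne : (inl (ofAdd (Pi.single i₀ (2 * (L : ℤ)))) : Multiplicative (Fin m → ℤ) ⋊[act] H)
      ≠ 1 := by
    intro h
    have h' : (Pi.single i₀ (2 * (L : ℤ)) : Fin m → ℤ) i₀ = (0 : Fin m → ℤ) i₀ :=
      congrFun (congrArg (fun g => toAdd g.left) h) i₀
    rw [Pi.single_eq_same, Pi.zero_apply] at h'
    omega
  have hmain := le_RFgrowth (hK (C * r) hCr) hmem hne
    (fun N hN hnot => pow_card_le_index_of_notMem hflip hswap hL hi₀ hN hnot)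
  have hRF0 : 0 ≤ RFgrowth (nu (Multiplicative (Fin m → ℤ) ⋊[act] H)) S (C * r) :=
    (Nat.cast_nonneg _).trans hmain
  have hfl : Real.log r ≤ 6 * (n + 1) := by
    have := (Nat.lt_floor_add_one (Real.log r / 6)).le
    rw [← hn] at this
    linarith
  calc Real.log r ^ T.card ≤ (6 * (n + 1 : ℝ)) ^ T.card := by gcongr
    _ = 6 ^ T.card * (((n + 1) ^ T.card : ℕ) : ℝ) := by push_cast; rw [mul_pow]
    _ ≤ C * RFgrowth (nu (Multiplicative (Fin m → ℤ) ⋊[act] H)) S (C * r) := by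
      gcongr
      linarith

theorem sInf_nu_eq_bot [Finite H] : sInf (nu (Multiplicative (Fin m → ℤ) ⋊[act] H)) = ⊥ := by
  refine (Subgroup.eq_bot_iff_forall _).2 fun g hg => ?_
  rw [Subgroup.mem_sInf] at hg
  by_contra hg1
  have hT : IsInvariantBlock act Finset.univ := by
    intro h d w hw i _
    choose c hc using fun i => hw i (Finset.mem_univ i)
    rw [show w = d • c from funext hc, map_zsmul]
    exact ⟨_, rfl⟩
  by_cases hright : g.right = 1
  · obtain ⟨i, hi⟩ : ∃ i, toAdd g.left i ≠ 0 := by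
      by_contra! h
      exact hg1 (SemidirectProduct.ext (toAdd.injective (funext h)) hright)
    obtain ⟨N, hN, hgN, -⟩ :=
      exists_separating_of_block hi hT (Finset.mem_univ i) le_rfl
    exact hgN (hg N hN)
  · obtain ⟨N, hN, hgN, -⟩ := exists_separating_of_right_ne_one hright
    exact hgN (hg N hN)

theorem exists_finset_closure_eq_top [Finite H] :
    ∃ S : Finset (Multiplicative (Fin m → ℤ) ⋊[act] H),
      Subgroup.closure (S : Set (Multiplicative (Fin m → ℤ) ⋊[act] H)) = ⊤ := by
  obtain ⟨A, hA⟩ := (Group.fg_iff_subgroup_fg (⊤ : Subgroup (Multiplicative (Fin m → ℤ)))).1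
    inferInstance
  classical
  have := Fintype.ofFinite H
  refine ⟨A.image inl ∪ Finset.univ.image inr, eq_top_iff.2 fun g _ => ?_⟩
  rw [← inl_left_mul_inr_right g, Finset.coe_union, Finset.coe_image, Finset.coe_image,
    Subgroup.closure_union, ← MonoidHom.map_closure, hA]
  exact mul_mem (Subgroup.mem_sup_left ⟨_, trivial, rfl⟩)
    (Subgroup.mem_sup_right (Subgroup.subset_closure ⟨_, by simp, rfl⟩))

end LatticeExtensionGrowth

section SignedPermutations

open Matrix

/-- The integral matrices preserving the dot product and fixing the basis vectors of index at
least `k`, i.e. the signed permutation matrices supported on the first `k` coordinates. -/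
def signedPermGroup (m k : ℕ) : Subgroup (GL (Fin m) ℤ) where
  carrier := {A | (∀ v w, (A.1 *ᵥ v) ⬝ᵥ (A.1 *ᵥ w) = v ⬝ᵥ w) ∧
    ∀ j : Fin m, k ≤ j.1 → A.1 *ᵥ Pi.single j 1 = Pi.single j 1}
  mul_mem' := by
    rintro A B ⟨hA, hA'⟩ ⟨hB, hB'⟩
    refine ⟨fun v w => ?_, fun j hj => ?_⟩
    · simp only [Units.val_mul, ← mulVec_mulVec, hA, hB]
    · rw [Units.val_mul, ← mulVec_mulVec, hB' j hj, hA' j hj]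
  one_mem' := ⟨fun v w => by simp, fun j _ => one_mulVec _⟩
  inv_mem' := by
    rintro A ⟨hA, hA'⟩
    have hcancel : ∀ v, (A⁻¹).1 *ᵥ (A.1 *ᵥ v) = v := fun v => by
      rw [mulVec_mulVec, Units.inv_mul, one_mulVec]
    have hcancel' : ∀ v, A.1 *ᵥ ((A⁻¹).1 *ᵥ v) = v := fun v => by
      rw [mulVec_mulVec, Units.mul_inv, one_mulVec]
    refine ⟨fun v w => ?_, fun j hj => ?_⟩
    · rw [← hA, hcancel', hcancel']
    · conv_lhs => rw [← hA' j hj]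
      exact hcancel _

variable {m k : ℕ}

theorem abs_entry_le_one (A : signedPermGroup m k) (i j : Fin m) : |A.1.1 i j| ≤ 1 := by
  have h := A.2.1 (Pi.single j 1) (Pi.single j 1)
  rw [mulVec_single_one, single_one_dotProduct, Pi.single_eq_same] at h
  have h1 : A.1.1 i j * A.1.1 i j ≤ 1 := by
    rw [← h]
    exact Finset.single_le_sum (f := fun i => A.1.1 i j * A.1.1 i j)
      (fun i _ => mul_self_nonneg _) (Finset.mem_univ i)
  exact abs_le_one_iff_mul_self_le_one.2 h1

instance : Finite (signedPermGroup m k) := by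
  have hfin : (Set.Icc (fun _ _ => -1 : Fin m → Fin m → ℤ) (fun _ _ => 1)).Finite :=
    Set.finite_Icc _ _
  have := hfin.to_subtype
  refine Finite.of_injective (β := Set.Icc (fun _ _ => -1 : Fin m → Fin m → ℤ) (fun _ _ => 1))
    (fun A => ⟨fun i j => A.1.1 i j, fun i j => (abs_le.1 (abs_entry_le_one A i j)).1,
      fun i j => (abs_le.1 (abs_entry_le_one A i j)).2⟩) fun A B h => ?_
  exact Subtype.ext (Units.ext (congrArg Subtype.val h))

theorem mulVec_apply_of_le (A : signedPermGroup m k) (w : Fin m → ℤ) {j : Fin m}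
    (hj : k ≤ j.1) : (A.1.1 *ᵥ w) j = w j := by
  have h := A.2.1 (Pi.single j 1) w
  rwa [A.2.2 j hj, single_one_dotProduct, single_one_dotProduct] at h

theorem entry_eq_zero_of_le (A : signedPermGroup m k) {i l : Fin m} (hi : i.1 < k)
    (hl : k ≤ l.1) : A.1.1 i l = 0 := by
  have h := congrFun (A.2.2 l hl) i
  rwa [mulVec_single_one, Pi.single_eq_of_ne (by rintro rfl; omega)] at h

/-- The sign change of one coordinate. -/
def signChange (i : Fin m) : GL (Fin m) ℤ :=
  have h : diagonal (Function.update (1 : Fin m → ℤ) i (-1)) *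
      diagonal (Function.update (1 : Fin m → ℤ) i (-1)) = 1 := by
    rw [diagonal_mul_diagonal, ← diagonal_one]
    congr 1
    funext j
    by_cases hj : j = i <;> simp [hj]
  ⟨diagonal (Function.update 1 i (-1)), diagonal (Function.update 1 i (-1)), h, h⟩

theorem signChange_mulVec (i : Fin m) (w : Fin m → ℤ) :
    (signChange i).1 *ᵥ w = w - Pi.single i (2 * w i) := by
  funext j
  simp only [signChange, mulVec_diagonal, Pi.sub_apply]
  by_cases hj : j = i
  · subst hj; simp; ring
  · simp [hj]

theorem signChange_mem {i : Fin m} (hi : i.1 < k) : signChange i ∈ signedPermGroup m k := by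
  refine ⟨fun v w => ?_, fun j hj => ?_⟩
  · refine Finset.sum_congr rfl fun j _ => ?_
    rw [signChange_mulVec, signChange_mulVec]
    by_cases hj : j = i
    · subst hj; simp; ring
    · simp [hj]
  · have hji : i ≠ j := by rintro rfl; omega
    rw [signChange_mulVec, Pi.single_eq_of_ne hji]
    simp

/-- The permutation matrix exchanging two coordinates. -/
def coordSwap (i j : Fin m) : GL (Fin m) ℤ :=
  have h : (Equiv.swap i j).permMatrix ℤ * (Equiv.swap i j).permMatrix ℤ = 1 := by
    rw [← permMatrix_mul, Equiv.swap_mul_self, permMatrix_one]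
  ⟨(Equiv.swap i j).permMatrix ℤ, (Equiv.swap i j).permMatrix ℤ, h, h⟩

theorem coordSwap_mulVec (i j : Fin m) (w : Fin m → ℤ) :
    (coordSwap i j).1 *ᵥ w = w ∘ Equiv.swap i j := permMatrix_mulVec _

theorem coordSwap_mulVec_single (i j l : Fin m) (a : ℤ) :
    (coordSwap i j).1 *ᵥ Pi.single l a = Pi.single (Equiv.swap i j l) a := by
  rw [coordSwap_mulVec]
  funext x
  simp only [Function.comp_apply, Pi.single_apply, Equiv.swap_apply_eq_iff]

theorem coordSwap_mem {i j : Fin m} (hi : i.1 < k) (hj : j.1 < k) :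
    coordSwap i j ∈ signedPermGroup m k := by
  refine ⟨fun v w => ?_, fun l hl => ?_⟩
  · rw [coordSwap_mulVec, coordSwap_mulVec]
    exact Equiv.sum_comp (Equiv.swap i j) fun x => v x * w x
  · rw [coordSwap_mulVec_single, Equiv.swap_apply_of_ne_of_ne]
    · rintro rfl; omega
    · rintro rfl; omega

/-- The action of an integral general linear group on `ℤ^m`, written multiplicatively. -/
def glAct (m : ℕ) : GL (Fin m) ℤ →* MulAut (Multiplicative (Fin m → ℤ)) where
  toFun A :=
    { toFun := fun v => ofAdd (A.1 *ᵥ toAdd v)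
      invFun := fun v => ofAdd ((A⁻¹).1 *ᵥ toAdd v)
      left_inv := fun v => by
        simp only [toAdd_ofAdd]
        rw [mulVec_mulVec, Units.inv_mul, one_mulVec, ofAdd_toAdd]
      right_inv := fun v => by
        simp only [toAdd_ofAdd]
        rw [mulVec_mulVec, Units.mul_inv, one_mulVec, ofAdd_toAdd]
      map_mul' := fun v w => by rw [toAdd_mul, mulVec_add, ofAdd_add] }
  map_one' := MulEquiv.ext fun v => by simp
  map_mul' A B := MulEquiv.ext fun v => by simp

/-- The action of the signed permutations on `ℤ^m`. -/
def signedPermAct (m k : ℕ) : signedPermGroup m k →* MulAut (Multiplicative (Fin m → ℤ)) :=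
  (glAct m).comp (signedPermGroup m k).subtype

theorem actVec_signedPermAct (A : signedPermGroup m k) (v : Fin m → ℤ) :
    actVec (signedPermAct m k) A v = A.1.1 *ᵥ v := rfl

/-- The first `k` coordinates. -/
def firstCoords (m k : ℕ) : Finset (Fin m) := Finset.univ.filter fun i => i.1 < k

theorem mem_firstCoords {i : Fin m} : i ∈ firstCoords m k ↔ i.1 < k := by simp [firstCoords]

theorem card_firstCoords (hkm : k ≤ m) : (firstCoords m k).card = k := by
  rw [firstCoords, Fin.card_filter_val_lt, min_eq_right hkm]

theorem isInvariantBlock_firstCoords :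
    IsInvariantBlock (signedPermAct m k) (firstCoords m k) := by
  intro A d w hw i hi
  rw [actVec_signedPermAct]
  rw [mulVec, dotProduct]
  refine Finset.dvd_sum fun l _ => ?_
  by_cases hl : l.1 < k
  · exact Dvd.dvd.mul_left (hw l (mem_firstCoords.2 hl)) _
  · rw [entry_eq_zero_of_le A (mem_firstCoords.1 hi) (not_lt.1 hl), zero_mul]
    exact dvd_zero d

theorem isInvariantBlock_singleton {j : Fin m} (hj : k ≤ j.1) :
    IsInvariantBlock (signedPermAct m k) {j} := by
  intro A d w hw i hi
  rw [Finset.mem_singleton] at hi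
  subst hi
  rw [actVec_signedPermAct, mulVec_apply_of_le A w hj]
  exact hw i (Finset.mem_singleton_self i)

theorem exists_isInvariantBlock (hk : 1 ≤ k) (hkm : k ≤ m) (i : Fin m) :
    ∃ T, IsInvariantBlock (signedPermAct m k) T ∧ i ∈ T ∧ T.card ≤ k := by
  by_cases hi : i.1 < k
  · exact ⟨_, isInvariantBlock_firstCoords, mem_firstCoords.2 hi, (card_firstCoords hkm).le⟩
  · exact ⟨_, isInvariantBlock_singleton (not_lt.1 hi), Finset.mem_singleton_self i, by simpa⟩

theorem growthEquiv_signedPermAct (hk : 1 ≤ k) (hkm : k ≤ m)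
    (S : Finset (Multiplicative (Fin m → ℤ) ⋊[signedPermAct m k] signedPermGroup m k))
    (hS : Subgroup.closure
      (S : Set (Multiplicative (Fin m → ℤ) ⋊[signedPermAct m k] signedPermGroup m k)) = ⊤) :
    GrowthEquiv
      (RFgrowth (nu (Multiplicative (Fin m → ℤ) ⋊[signedPermAct m k] signedPermGroup m k)) S)
      (fun r => (Real.log r) ^ k) := by
  refine ⟨growthLE_log_pow (exists_isInvariantBlock hk hkm) S, ?_⟩
  have hcard := card_firstCoords hkm
  have h := log_pow_growthLE (act := signedPermAct m k) (T := firstCoords m k) (i₀ := ⟨0, by omega⟩)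
    (by rw [hcard]; exact exists_isInvariantBlock hk hkm)
    (fun i hi => ⟨⟨signChange i, signChange_mem (mem_firstCoords.1 hi)⟩, signChange_mulVec i⟩)
    (fun i hi j hj => ⟨⟨coordSwap i j, coordSwap_mem (mem_firstCoords.1 hi)
      (mem_firstCoords.1 hj)⟩, fun a => by
        rw [actVec_signedPermAct, coordSwap_mulVec_single, Equiv.swap_apply_left]⟩)
    (mem_firstCoords.2 hk) S hS
  rwa [hcard] at h

end SignedPermutations

theorem growthEquiv_log_pow_zero_of_subsingleton {G : Type*} [Group G] [Subsingleton G]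
    (P : Set (Subgroup G)) (S : Finset G) :
    GrowthEquiv (RFgrowth P S) (fun r => (Real.log r) ^ 0) := by
  have h : ∀ r, RFgrowth P S r = 1 := fun r => by
    have hempty : wordBall S r \ {1} = ∅ :=
      Set.eq_empty_of_forall_notMem fun g hg => hg.2 (Subsingleton.elim g 1)
    simp [RFgrowth, hempty]
  exact ⟨⟨1, one_pos, fun r _ => by simp [h]⟩, ⟨1, one_pos, fun r _ => by simp [h]⟩⟩

/-- for every `m ≥ 1` and `1 ≤ k ≤ m` there is a finite group `H` and a
representation `φ : H → GL(m,ℤ)` such that the semidirect product `G = ℤ^m ⋊_φ H`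
has residual finiteness growth `≈ log^k` (for every finite generating set). In
particular, for every `k ∈ ℕ` there is a finitely generated residually finite group
whose residual finiteness growth is `≈ log^k`. -/
theorem stmt_19 :
    (∀ m k : ℕ, 1 ≤ k → k ≤ m →
      ∃ (H : Type) (_ : Group H) (_ : Fintype H)
        (φ : H →* Matrix.GeneralLinearGroup (Fin m) ℤ)
        (act : H →* MulAut (Multiplicative (Fin m → ℤ))),
        (∀ (h : H) (v : Fin m → ℤ),
          Multiplicative.toAdd (act h (Multiplicative.ofAdd v)) =
            ((φ h : Matrix (Fin m) (Fin m) ℤ)).mulVec v) ∧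
        ∀ S : Finset (SemidirectProduct (Multiplicative (Fin m → ℤ)) H act),
          Subgroup.closure (S : Set (SemidirectProduct (Multiplicative (Fin m → ℤ)) H act)) = ⊤ →
          GrowthEquiv (RFgrowth (nu (SemidirectProduct (Multiplicative (Fin m → ℤ)) H act)) S)
            (fun r => (Real.log r) ^ k)) ∧
    (∀ k : ℕ, ∃ (G : Type) (_ : Group G) (S : Finset G),
      Subgroup.closure (S : Set G) = ⊤ ∧ sInf (nu G) = ⊥ ∧
      GrowthEquiv (RFgrowth (nu G) S) (fun r => (Real.log r) ^ k)) := by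
  refine ⟨fun m k hk hkm => ?_, fun k => ?_⟩
  · exact ⟨signedPermGroup m k, inferInstance, Fintype.ofFinite _, (signedPermGroup m k).subtype,
      signedPermAct m k, fun h v => rfl, growthEquiv_signedPermAct hk hkm⟩
  · rcases Nat.eq_zero_or_pos k with rfl | hk
    · exact ⟨PUnit, inferInstance, ∅, Subsingleton.elim _ _, Subsingleton.elim _ _,
        growthEquiv_log_pow_zero_of_subsingleton _ _⟩
    · obtain ⟨S, hS⟩ := exists_finset_closure_eq_top (act := signedPermAct k k)
      exact ⟨_, inferInstance, S, hS, sInf_nu_eq_bot, growthEquiv_signedPermAct hk le_rfl S hS⟩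
end
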